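/- Under the one-shot random-canary setup, E[(1/k) Σ_{i=1}^k ⟨c_i, ρ⟩²] = ‖X‖²/d + 1 + (k−1)/d + σ². -/

import Mathlib

open MeasureTheory ProbabilityTheory Real Filter
open scoped InnerProductSpace Topology ENNReal

/-- The standard Gaussian measure `N(0, I_d)` on `ℝ^d`, obtained by mapping the product
of `d` independent one-dimensional standard Gaussians onto `EuclideanSpace ℝ (Fin d)`. -/
noncomputable def stdGaussianE (d : ℕ) : Measure (EuclideanSpace ℝ (Fin d)) :=
  Measure.map (⇑(EuclideanSpace.equiv (Fin d) ℝ).symm)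
    (Measure.pi fun _ : Fin d => gaussianReal 0 1)

/-- The joint distribution of `k` i.i.d. canaries `c_1, …, c_k` drawn from the
(uniform) measure `μs` on the unit sphere, together with an independent standard
Gaussian vector `Z ∼ N(0, I_d)`.  A sample point is `ω = ((c_1, …, c_k), Z)`. -/
noncomputable def canaryP (d k : ℕ) (μs : Measure (EuclideanSpace ℝ (Fin d))) :
    Measure ((Fin k → EuclideanSpace ℝ (Fin d)) × EuclideanSpace ℝ (Fin d)) :=
  (Measure.pi fun _ : Fin k => μs).prod (stdGaussianE d)

/-- The mechanism output `ρ = X + ∑_{i=1}^k c_i + σ Z`. -/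
noncomputable def rhoF (d k : ℕ) (X : EuclideanSpace ℝ (Fin d)) (σ : ℝ)
    (ω : (Fin k → EuclideanSpace ℝ (Fin d)) × EuclideanSpace ℝ (Fin d)) :
    EuclideanSpace ℝ (Fin d) :=
  X + (∑ i, ω.1 i) + σ • ω.2

lemma aux_sq {Ω : Type*} [MeasurableSpace Ω] (P : Measure Ω) [IsProbabilityMeasure P]
    (g : Ω → ℝ) (hg : MemLp g 2 P) (h0 : ∫ x, g x ∂P = 0) (a : ℝ) :
    ∫ x, (a + g x) ^ 2 ∂P = a ^ 2 + ∫ x, g x ^ 2 ∂P := by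
  have hi : Integrable g P := hg.integrable (by norm_num)
  have h2 : Integrable (fun x => g x ^ 2) P := hg.integrable_sq
  have : (fun x => (a + g x) ^ 2) = fun x => (a ^ 2 + 2 * a * g x) + g x ^ 2 := by
    ext x; ring
  have h3 : Integrable (fun x => a ^ 2 + 2 * a * g x) P :=
    (integrable_const _).add (hi.const_mul _)
  rw [this, integral_add h3 h2,
    integral_add (integrable_const _) (hi.const_mul _), integral_const_mul, h0]
  simp

lemma stdGaussianE_eq (d : ℕ) : stdGaussianE d = stdGaussian (EuclideanSpace ℝ (Fin d)) := by
  rw [← map_pi_eq_stdGaussian]; rfl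

lemma gauss_mean (d : ℕ) (c : EuclideanSpace ℝ (Fin d)) :
    ∫ z, ⟪c, z⟫_ℝ ∂(stdGaussian (EuclideanSpace ℝ (Fin d))) = 0 :=
  integral_strongDual_stdGaussian (innerSL ℝ c)

lemma gauss_memLp (d : ℕ) (c : EuclideanSpace ℝ (Fin d)) :
    MemLp (fun z => ⟪c, z⟫_ℝ) 2 (stdGaussian (EuclideanSpace ℝ (Fin d))) :=
  (innerSL ℝ c).comp_memLp' (IsGaussian.memLp_two_id)

lemma gauss_sq (d : ℕ) (c : EuclideanSpace ℝ (Fin d)) :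
    ∫ z, ⟪c, z⟫_ℝ ^ 2 ∂(stdGaussian (EuclideanSpace ℝ (Fin d))) = ‖c‖ ^ 2 := by
  have h := variance_dual_stdGaussian (innerSL ℝ c)
  rw [innerSL_apply_norm] at h
  rw [← h, variance_of_integral_eq_zero]
  · rfl
  · exact (innerSL ℝ c).continuous.aemeasurable
  · exact integral_strongDual_stdGaussian (innerSL ℝ c)

section
variable {d : ℕ} {μs : Measure (EuclideanSpace ℝ (Fin d))} [IsProbabilityMeasure μs]

lemma sph_ae (hsphere : μs (Metric.sphere (0 : EuclideanSpace ℝ (Fin d)) 1) = 1) :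
    ∀ᵐ c ∂μs, ‖c‖ = 1 := by
  have : ∀ᵐ c ∂μs, c ∈ Metric.sphere (0 : EuclideanSpace ℝ (Fin d)) 1 :=
    (mem_ae_iff_prob_eq_one (Metric.isClosed_sphere.measurableSet)).2 hsphere
  simpa using this

lemma sph_memLp_id (hsphere : μs (Metric.sphere (0 : EuclideanSpace ℝ (Fin d)) 1) = 1) :
    MemLp (fun c => c) 2 μs :=
  MemLp.of_bound (by fun_prop) 1 ((sph_ae hsphere).mono fun c hc => hc.le)

lemma sph_memLp (hsphere : μs (Metric.sphere (0 : EuclideanSpace ℝ (Fin d)) 1) = 1)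
    (x : EuclideanSpace ℝ (Fin d)) : MemLp (fun c => ⟪x, c⟫_ℝ) 2 μs :=
  (innerSL ℝ x).comp_memLp' (sph_memLp_id hsphere)

lemma sph_mean (hinv : ∀ O : EuclideanSpace ℝ (Fin d) ≃ₗᵢ[ℝ] EuclideanSpace ℝ (Fin d),
      μs.map O = μs) (x : EuclideanSpace ℝ (Fin d)) : ∫ c, ⟪x, c⟫_ℝ ∂μs = 0 := by
  have h : ∫ c, ⟪x, c⟫_ℝ ∂μs = ∫ c, ⟪x, -c⟫_ℝ ∂μs := by
    conv_lhs => rw [← hinv (LinearIsometryEquiv.neg ℝ)]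
    rw [integral_map (LinearIsometryEquiv.continuous _).aemeasurable (by fun_prop)]
    rfl
  simp only [inner_neg_right, integral_neg] at h
  linarith

lemma sph_rot (hinv : ∀ O : EuclideanSpace ℝ (Fin d) ≃ₗᵢ[ℝ] EuclideanSpace ℝ (Fin d),
      μs.map O = μs) (x y : EuclideanSpace ℝ (Fin d)) (hxy : ‖x‖ = ‖y‖) :
    ∫ c, ⟪x, c⟫_ℝ ^ 2 ∂μs = ∫ c, ⟪y, c⟫_ℝ ^ 2 ∂μs := by
  set O := (ℝ ∙ (x - y))ᗮ.reflection with hO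
  have hOx : O x = y := Submodule.reflection_sub hxy
  conv_rhs => rw [← hinv O]
  rw [integral_map (LinearIsometryEquiv.continuous _).aemeasurable (by fun_prop)]
  simp [← hOx]

lemma sph_sq (hd : 2 ≤ d)
    (hsphere : μs (Metric.sphere (0 : EuclideanSpace ℝ (Fin d)) 1) = 1)
    (hinv : ∀ O : EuclideanSpace ℝ (Fin d) ≃ₗᵢ[ℝ] EuclideanSpace ℝ (Fin d),
      μs.map O = μs) (x : EuclideanSpace ℝ (Fin d)) :
    ∫ c, ⟪x, c⟫_ℝ ^ 2 ∂μs = ‖x‖ ^ 2 / d := by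
  set b := EuclideanSpace.basisFun (Fin d) ℝ
  have key : ∀ i, ∫ c, ⟪x, c⟫_ℝ ^ 2 ∂μs = ‖x‖ ^ 2 * ∫ c, ⟪b i, c⟫_ℝ ^ 2 ∂μs := by
    intro i
    rw [sph_rot hinv x (‖x‖ • b i) (by rw [norm_smul, b.norm_eq_one]; simp),
      ← integral_const_mul]
    simp only [real_inner_smul_left, mul_pow]
  have hsum : ∑ i, ∫ c, ⟪b i, c⟫_ℝ ^ 2 ∂μs = 1 := by
    rw [← integral_finsetSum _ (fun i _ => (sph_memLp hsphere (b i)).integrable_sq)]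
    have : ∀ᵐ c ∂μs, ∑ i, ⟪b i, c⟫_ℝ ^ 2 = 1 := by
      filter_upwards [sph_ae hsphere] with c hc
      rw [b.sum_sq_inner_right, hc]; norm_num
    rw [integral_congr_ae this]; simp
  have h2 : (d : ℝ) * ∫ c, ⟪x, c⟫_ℝ ^ 2 ∂μs = ‖x‖ ^ 2 := by
    have : ∑ i : Fin d, ∫ c, ⟪x, c⟫_ℝ ^ 2 ∂μs = ‖x‖ ^ 2 := by
      rw [Finset.sum_congr rfl (fun i _ => key i), ← Finset.mul_sum, hsum, mul_one]
    simpa using this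
  have : (d : ℝ) ≠ 0 := by positivity
  rw [← h2]; field_simp

lemma pi_ae {k : ℕ} (hsphere : μs (Metric.sphere (0 : EuclideanSpace ℝ (Fin d)) 1) = 1)
    (i : Fin k) : ∀ᵐ c ∂(Measure.pi fun _ : Fin k => μs), ‖c i‖ = 1 :=
  (measurePreserving_eval (fun _ : Fin k => μs) i).quasiMeasurePreserving.ae (sph_ae hsphere)

lemma pi_memLp {k : ℕ} (hsphere : μs (Metric.sphere (0 : EuclideanSpace ℝ (Fin d)) 1) = 1)
    (X : EuclideanSpace ℝ (Fin d)) :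
    MemLp (fun c : Fin k → EuclideanSpace ℝ (Fin d) => X + ∑ j, c j) 2
      (Measure.pi fun _ : Fin k => μs) := by
  refine (memLp_const X).add (memLp_finsetSum _ fun j _ => ?_)
  exact (sph_memLp_id hsphere).comp_measurePreserving
    (measurePreserving_eval (fun _ : Fin k => μs) j)

lemma pi_int {k : ℕ} (hsphere : μs (Metric.sphere (0 : EuclideanSpace ℝ (Fin d)) 1) = 1)
    (X : EuclideanSpace ℝ (Fin d)) (i : Fin k) :
    Integrable (fun c : Fin k → EuclideanSpace ℝ (Fin d) => ⟪c i, X + ∑ j, c j⟫_ℝ ^ 2)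
      (Measure.pi fun _ : Fin k => μs) := by
  refine MemLp.integrable_sq ((pi_memLp hsphere X).of_le (by fun_prop) ?_)
  filter_upwards [pi_ae hsphere i] with c hc
  simpa [hc] using norm_inner_le_norm (𝕜 := ℝ) (c i) (X + ∑ j, c j)

lemma all_int {k : ℕ} (hsphere : μs (Metric.sphere (0 : EuclideanSpace ℝ (Fin d)) 1) = 1)
    (X : EuclideanSpace ℝ (Fin d)) (σ : ℝ) (i : Fin k) :
    Integrable (fun ω => ⟪ω.1 i, rhoF d k X σ ω⟫_ℝ ^ 2)
      ((Measure.pi fun _ : Fin k => μs).prod (stdGaussian (EuclideanSpace ℝ (Fin d)))) := by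
  have hρ : MemLp (rhoF d k X σ) 2
      ((Measure.pi fun _ : Fin k => μs).prod (stdGaussian (EuclideanSpace ℝ (Fin d)))) := by
    refine MemLp.add ((pi_memLp hsphere X).comp_measurePreserving measurePreserving_fst)
      (MemLp.const_smul ?_ σ)
    exact (IsGaussian.memLp_two_id).comp_measurePreserving measurePreserving_snd
  refine MemLp.integrable_sq (hρ.of_le (by unfold rhoF; fun_prop) ?_)
  filter_upwards [measurePreserving_fst.quasiMeasurePreserving.ae (pi_ae hsphere i)] with c hc
  simpa [hc] using norm_inner_le_norm (𝕜 := ℝ) (c.1 i) (rhoF d k X σ c)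

lemma inner_val {n : ℕ} (hd : 2 ≤ d)
    (hsphere : μs (Metric.sphere (0 : EuclideanSpace ℝ (Fin d)) 1) = 1)
    (hinv : ∀ O : EuclideanSpace ℝ (Fin d) ≃ₗᵢ[ℝ] EuclideanSpace ℝ (Fin d),
      μs.map O = μs) (c : EuclideanSpace ℝ (Fin d)) (hc : ‖c‖ = 1) (a : ℝ) :
    ∫ r : Fin n → EuclideanSpace ℝ (Fin d),
      (a + (∑ j, fun r : Fin n → EuclideanSpace ℝ (Fin d) => ⟪c, r j⟫_ℝ) r) ^ 2
        ∂(Measure.pi fun _ : Fin n => μs) = a ^ 2 + n / d := by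
  have hm : ∀ j : Fin n, MemLp (fun r : Fin n → EuclideanSpace ℝ (Fin d) => ⟪c, r j⟫_ℝ) 2
      (Measure.pi fun _ : Fin n => μs) := fun j =>
    (sph_memLp hsphere c).comp_measurePreserving
      (measurePreserving_eval (fun _ : Fin n => μs) j)
  have hM := memLp_finsetSum' Finset.univ fun j _ => hm j
  have h0 : ∫ r, (∑ j, fun r : Fin n → EuclideanSpace ℝ (Fin d) => ⟪c, r j⟫_ℝ) r
      ∂(Measure.pi fun _ : Fin n => μs) = 0 := by
    simp only [Finset.sum_apply]
    rw [integral_finsetSum _ fun j _ => (hm j).integrable (by norm_num)]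
    refine Finset.sum_eq_zero fun j _ => ?_
    rw [← sph_mean hinv c]
    exact integral_comp_eval (μ := fun _ : Fin n => μs) (i := j) (f := fun z => ⟪c, z⟫_ℝ)
      (by fun_prop)
  rw [aux_sq _ _ hM h0]
  congr 1
  rw [← variance_of_integral_eq_zero hM.aemeasurable h0]
  have hv := variance_sum_pi (μ := fun _ : Fin n => μs)
    (X := fun _ z => ⟪c, z⟫_ℝ) (fun _ => sph_memLp hsphere c)
  rw [hv]
  simp [variance_of_integral_eq_zero (sph_memLp hsphere c).aemeasurable (sph_mean hinv c),
    sph_sq hd hsphere hinv, hc, div_eq_mul_inv]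

lemma insert_eq {n : ℕ} (X : EuclideanSpace ℝ (Fin d)) (i : Fin (n + 1))
    (c : EuclideanSpace ℝ (Fin d)) (hc : ‖c‖ = 1) (r : Fin n → EuclideanSpace ℝ (Fin d)) :
    ⟪(i.insertNth c r : Fin (n + 1) → EuclideanSpace ℝ (Fin d)) i,
       X + ∑ j, (i.insertNth c r : Fin (n + 1) → EuclideanSpace ℝ (Fin d)) j⟫_ℝ
        = (1 + ⟪X, c⟫_ℝ) + (∑ j, fun r : Fin n → EuclideanSpace ℝ (Fin d) => ⟪c, r j⟫_ℝ) r := by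
  rw [Fin.sum_univ_succAbove _ i]
  simp [inner_add_right, inner_sum, hc, real_inner_comm]
  ring

lemma split_eq {n : ℕ} (i : Fin (n + 1)) (f : (Fin (n + 1) → EuclideanSpace ℝ (Fin d)) → ℝ)
    (hf : Integrable f (Measure.pi fun _ : Fin (n + 1) => μs)) :
    ∫ c, f c ∂(Measure.pi fun _ : Fin (n + 1) => μs) =
    ∫ c, ∫ r : Fin n → EuclideanSpace ℝ (Fin d), f (i.insertNth c r)
      ∂(Measure.pi fun _ : Fin n => μs) ∂μs := by
  have mp := (measurePreserving_piFinSuccAbove (fun _ : Fin (n + 1) => μs) i).symm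
  have hint := (mp.integrable_comp_emb (MeasurableEquiv.measurableEmbedding _)).2 hf
  rw [← mp.integral_comp (MeasurableEquiv.measurableEmbedding _)]
  exact integral_prod _ hint

lemma pi_val {n : ℕ} (hd : 2 ≤ d)
    (hsphere : μs (Metric.sphere (0 : EuclideanSpace ℝ (Fin d)) 1) = 1)
    (hinv : ∀ O : EuclideanSpace ℝ (Fin d) ≃ₗᵢ[ℝ] EuclideanSpace ℝ (Fin d),
      μs.map O = μs)
    (X : EuclideanSpace ℝ (Fin d)) (i : Fin (n + 1)) :
    ∫ c : Fin (n + 1) → EuclideanSpace ℝ (Fin d), ⟪c i, X + ∑ j, c j⟫_ℝ ^ 2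
      ∂(Measure.pi fun _ : Fin (n + 1) => μs) = ‖X‖ ^ 2 / d + 1 + n / d := by
  rw [split_eq i _ (pi_int hsphere X i)]
  have hin : ∀ᵐ c ∂μs, ∫ r : Fin n → EuclideanSpace ℝ (Fin d),
      ⟪(i.insertNth c r : Fin (n + 1) → EuclideanSpace ℝ (Fin d)) i,
       X + ∑ j, (i.insertNth c r : Fin (n + 1) → EuclideanSpace ℝ (Fin d)) j⟫_ℝ ^ 2
        ∂(Measure.pi fun _ : Fin n => μs) = (1 + ⟪X, c⟫_ℝ) ^ 2 + n / d := by
    filter_upwards [sph_ae hsphere] with c hc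
    simp only [insert_eq X i c hc]
    exact inner_val hd hsphere hinv c hc _
  rw [integral_congr_ae hin]
  have hl : MemLp (fun c => (1 : ℝ) + ⟪X, c⟫_ℝ) 2 μs :=
    (memLp_const (1 : ℝ)).add (sph_memLp hsphere X)
  have hsqi : Integrable (fun c => ((1 : ℝ) + ⟪X, c⟫_ℝ) ^ 2) μs := hl.integrable_sq
  rw [integral_add hsqi (integrable_const _),
    aux_sq _ _ (sph_memLp hsphere X) (sph_mean hinv X), sph_sq hd hsphere hinv]
  simp
  ring
end

/-- Under the one-shot random-canary setup,
`E[(1/k) ∑ᵢ ⟪c_i, ρ⟫²] = ‖X‖²/d + 1 + (k-1)/d + σ²`. -/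
theorem mean_avg_sq_canary_inner (d k : ℕ) (hd : 2 ≤ d) (hk : 1 ≤ k)
    (X : EuclideanSpace ℝ (Fin d)) (σ : ℝ) (hσ : 0 < σ)
    (μs : Measure (EuclideanSpace ℝ (Fin d))) [IsProbabilityMeasure μs]
    (hsphere : μs (Metric.sphere (0 : EuclideanSpace ℝ (Fin d)) 1) = 1)
    (hinv : ∀ O : EuclideanSpace ℝ (Fin d) ≃ₗᵢ[ℝ] EuclideanSpace ℝ (Fin d),
      μs.map O = μs) :
    (∫ ω, (1 / k : ℝ) * ∑ i, ⟪ω.1 i, rhoF d k X σ ω⟫_ℝ ^ 2 ∂(canaryP d k μs)) =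
      ‖X‖ ^ 2 / d + 1 + (k - 1) / d + σ ^ 2 := by
  obtain ⟨n, rfl⟩ : ∃ n, k = n + 1 := ⟨k - 1, by omega⟩
  have main : ∀ i, ∫ ω, ⟪ω.1 i, rhoF d (n + 1) X σ ω⟫_ℝ ^ 2 ∂(canaryP d (n + 1) μs)
      = ‖X‖ ^ 2 / d + 1 + n / d + σ ^ 2 := by
    intro i
    rw [canaryP, stdGaussianE_eq, integral_prod _ (all_int hsphere X σ i)]
    have hin : ∀ᵐ c ∂(Measure.pi fun _ : Fin (n + 1) => μs),
        ∫ z, ⟪c i, rhoF d (n + 1) X σ (c, z)⟫_ℝ ^ 2 ∂(stdGaussian (EuclideanSpace ℝ (Fin d)))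
          = ⟪c i, X + ∑ j, c j⟫_ℝ ^ 2 + σ ^ 2 := by
      filter_upwards [pi_ae hsphere i] with c hc
      have e : ∀ z, ⟪c i, rhoF d (n + 1) X σ (c, z)⟫_ℝ
          = ⟪c i, X + ∑ j, c j⟫_ℝ + ⟪σ • c i, z⟫_ℝ := by
        intro z
        rw [rhoF, inner_add_right _ _ (σ • z), real_inner_smul_left, real_inner_smul_right]
      simp only [e]
      rw [aux_sq _ _ (gauss_memLp d _) (gauss_mean d _), gauss_sq, norm_smul, hc]
      simp
    refine (integral_congr_ae hin).trans ?_
    rw [integral_add (pi_int hsphere X i) (integrable_const _), pi_val hd hsphere hinv]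
    simp
  rw [integral_const_mul, integral_finsetSum _ fun i _ => by
    rw [canaryP, stdGaussianE_eq]; exact all_int hsphere X σ i]
  simp only [main]
  have : ((n : ℝ) + 1) ≠ 0 := by positivity
  simp
  field_simp
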